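/- Every singular point of a hypersurface V ⊂ ℙⁿ is a flex point of V, i.e., if p ∈ V and the gradient of a defining squarefree polynomial f vanishes at p, then there exists a line through p with order of contact at least n+1 with V at p. -/

import Mathlib

/-!
STATEMENT 8: Every singular point of a hypersurface `V = Z(f) ⊂ ℙⁿ` (`f` squarefree
homogeneous) is a flex point: if `p ∈ V` and all first partial derivatives of `f`
vanish at `p`, then there is a line through `p` whose order of contact with `V` at `p`
is at least `n+1`.

Conventions: nonzero representatives in `K^{n+1}`; a line through `p` is given by a
nonzero `q` not proportional to `p`, and its order of contact at `p` is the `t`-adic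
valuation (in `ℕ∞`) of `f(p + t q)`.
-/

open MvPolynomial Polynomial
open scoped Classical

/-- The `k`-th directional Taylor coefficient `f_k(x,y)`, characterized by
`f(x + t y) = Σ_k f_k(x,y) t^k / k!`. -/
noncomputable def dirCoeff {K : Type} [CommRing K] {n : ℕ}
    (f : MvPolynomial (Fin (n + 1)) K) (k : ℕ) :
    MvPolynomial (Fin (n + 1) ⊕ Fin (n + 1)) K :=
  (k.factorial : MvPolynomial (Fin (n + 1) ⊕ Fin (n + 1)) K) *
    (Polynomial.coeff
      (MvPolynomial.aeval
        (fun i => Polynomial.C (MvPolynomial.X (Sum.inl i)) +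
          Polynomial.X * Polynomial.C (MvPolynomial.X (Sum.inr i))) f) k)

/-- The restriction of `f` to the line `t ↦ p + t q`. -/
noncomputable def linePoly {K : Type} [CommRing K] {n : ℕ}
    (f : MvPolynomial (Fin (n + 1)) K) (p q : Fin (n + 1) → K) : Polynomial K :=
  MvPolynomial.aeval (fun i => Polynomial.C (p i) + Polynomial.X * Polynomial.C (q i)) f

/-- Order of contact at `p` of the line through `p` and `q` with `Z(f)`. -/
noncomputable def contactOrder {K : Type} [Field K] {n : ℕ}
    (f : MvPolynomial (Fin (n + 1)) K) (p q : Fin (n + 1) → K) : ℕ∞ :=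
  if linePoly f p q = 0 then ⊤ else ((linePoly f p q).rootMultiplicity 0 : ℕ∞)

/-- The order of osculation `μ_p(V)`: supremum of orders of contact over the lines
through `p` (represented by nonzero `q` not proportional to `p`). -/
noncomputable def oscOrder {K : Type} [Field K] {n : ℕ}
    (f : MvPolynomial (Fin (n + 1)) K) (p : Fin (n + 1) → K) : ℕ∞ :=
  ⨆ q : {q : Fin (n + 1) → K // q ≠ 0 ∧ ¬∃ c : K, q = c • p},
    contactOrder f p (q : Fin (n + 1) → K)

/-- The condition `Z_p^k = {p}`. -/
def ZpkTrivial {K : Type} [Field K] {n : ℕ}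
    (f : MvPolynomial (Fin (n + 1)) K) (p : Fin (n + 1) → K) (k : ℕ) : Prop :=
  ∀ q : Fin (n + 1) → K, q ≠ 0 →
    (∀ j, 1 ≤ j → j ≤ k → MvPolynomial.eval (Sum.elim p q) (dirCoeff f j) = 0) →
      ∃ c : K, q = c • p


/-- The ideal of polynomials vanishing at the origin of affine `N`-space has height at least `N`. -/
theorem le_height_vanishingIdeal_zero (K : Type) [Field K] (N : ℕ) :
    (N : ℕ∞) ≤ (MvPolynomial.vanishingIdeal K {(0 : Fin N → K)}).height := by
  let φ : ℕ → MvPolynomial (Fin N) K →ₐ[K] MvPolynomial (Fin N) K := fun i =>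
    MvPolynomial.aeval (fun j => if (j : ℕ) < i then 0 else MvPolynomial.X j)
  have hφ : ∀ i j, φ i (MvPolynomial.X j) = if (j : ℕ) < i then 0 else MvPolynomial.X j := by
    intro i j
    simp [φ]
  have hprime : ∀ i, (RingHom.ker (φ i)).IsPrime := fun i => RingHom.ker_isPrime _
  have hcomp : ∀ i, (φ (i + 1)).comp (φ i) = φ (i + 1) := by
    intro i
    refine MvPolynomial.algHom_ext fun j => ?_
    rw [AlgHom.comp_apply, hφ i]
    split_ifs with h
    · rw [map_zero, hφ, if_pos (by omega)]
    · rfl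
  have hlt : ∀ i, i < N → RingHom.ker (φ i) < RingHom.ker (φ (i + 1)) := by
    intro i hi
    refine lt_of_le_of_ne (fun x hx => ?_) fun h => ?_
    · rw [RingHom.mem_ker] at hx ⊢
      rw [← hcomp i, AlgHom.comp_apply, hx, map_zero]
    · have hmem : MvPolynomial.X ⟨i, hi⟩ ∈ RingHom.ker (φ (i + 1)) := by
        rw [RingHom.mem_ker, hφ]
        simp
      rw [← h, RingHom.mem_ker, hφ] at hmem
      simp at hmem
  have hheight : ∀ i, i ≤ N → (i : ℕ∞) ≤ (RingHom.ker (φ i)).height := by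
    intro i
    induction i with
    | zero => simp
    | succ i ih =>
      intro hi
      have := hprime i
      have := hprime (i + 1)
      push_cast
      exact (add_le_add_left (ih (by omega)) 1).trans
        (Ideal.height_add_one_le_of_lt_of_isPrime (hlt i (by omega)))
  refine (hheight N le_rfl).trans (Ideal.height_mono fun x hx => ?_)
  rw [MvPolynomial.mem_vanishingIdeal_singleton_iff]
  have hzero : (MvPolynomial.aeval (0 : Fin N → K)).comp (φ N) = MvPolynomial.aeval 0 := by
    refine MvPolynomial.algHom_ext fun j => ?_
    rw [AlgHom.comp_apply, hφ, if_pos j.2]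
    simp
  rw [RingHom.mem_ker] at hx
  rw [← hzero, AlgHom.comp_apply, hx, map_zero]

/-- Over an algebraically closed field, fewer than `N` polynomials in `N` variables that vanish at
the origin have a common zero other than the origin. -/
theorem exists_ne_zero_forall_eval_eq_zero {K : Type} [Field K] [IsAlgClosed K] {m N : ℕ}
    (hmN : m < N) (g : Fin m → MvPolynomial (Fin N) K) (hg : ∀ j, MvPolynomial.eval 0 (g j) = 0) :
    ∃ q : Fin N → K, q ≠ 0 ∧ ∀ j, MvPolynomial.eval q (g j) = 0 := by
  by_contra! hcon
  have hlocus : MvPolynomial.zeroLocus K (Ideal.span (Set.range g)) = {0} := by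
    rw [MvPolynomial.zeroLocus_span]
    ext x
    simp only [Set.mem_ofPred_eq, Set.forall_mem_range, Set.mem_singleton_iff,
      MvPolynomial.aeval_eq_eval]
    refine ⟨fun h => ?_, fun h j => h ▸ hg j⟩
    by_contra hx
    obtain ⟨j, hj⟩ := hcon x hx
    exact hj (h j)
  have hrad := MvPolynomial.vanishingIdeal_zeroLocus_eq_radical (k := K) (K := K)
    (Ideal.span (Set.range g))
  rw [hlocus] at hrad
  have hprime : (MvPolynomial.vanishingIdeal K {(0 : Fin N → K)}).IsPrime :=
    (MvPolynomial.isMaximal_iff_eq_vanishingIdeal_singleton.mpr ⟨0, rfl⟩).isPrime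
  have hmin : MvPolynomial.vanishingIdeal K {(0 : Fin N → K)} ∈
      (Ideal.span (Set.range g)).minimalPrimes := by
    rw [← Ideal.radical_minimalPrimes, ← hrad, Ideal.minimalPrimes_eq_subsingleton_self]
    exact Set.mem_singleton _
  have hle := (le_height_vanishingIdeal_zero K N).trans
    (Ideal.height_le_card_of_mem_minimalPrimes_span (Set.finite_range g) hmin)
  have hcard : (Set.range g).ncard ≤ m := by
    simpa [Set.image_univ, Set.ncard_univ] using
      Set.ncard_image_le (Set.finite_univ (α := Fin m)) (f := g)
  have : N ≤ (Set.range g).ncard := by exact_mod_cast hle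
  omega

section LinePoly

variable {K : Type} [CommRing K] {n : ℕ}

theorem linePoly_zero_right (f : MvPolynomial (Fin (n + 1)) K) (p : Fin (n + 1) → K) :
    linePoly f p 0 = Polynomial.C (MvPolynomial.eval p f) := by
  induction f using MvPolynomial.induction_on with
  | C a => simp [linePoly, Polynomial.algebraMap_eq]
  | add f g hf hg => simp_all [linePoly]
  | mul_X f i hf => simp_all [linePoly]

theorem coeff_zero_linePoly (f : MvPolynomial (Fin (n + 1)) K) (p q : Fin (n + 1) → K) :
    (linePoly f p q).coeff 0 = MvPolynomial.eval p f := by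
  induction f using MvPolynomial.induction_on with
  | C a => simp [linePoly, Polynomial.algebraMap_eq]
  | add f g hf hg => simp_all [linePoly]
  | mul_X f i hf => simp_all [linePoly, Polynomial.mul_coeff_zero]

theorem coeff_one_linePoly (f : MvPolynomial (Fin (n + 1)) K) (p q : Fin (n + 1) → K) :
    (linePoly f p q).coeff 1 = ∑ i, MvPolynomial.eval p (MvPolynomial.pderiv i f) * q i := by
  induction f using MvPolynomial.induction_on with
  | C a => simp [linePoly, Polynomial.algebraMap_eq]
  | add f g hf hg =>
    have hadd : linePoly (f + g) p q = linePoly f p q + linePoly g p q := map_add _ _ _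
    simp [hadd, hf, hg, add_mul, Finset.sum_add_distrib]
  | mul_X f i hf =>
    have hmul : linePoly (f * MvPolynomial.X i) p q =
        linePoly f p q * (Polynomial.C (p i) + Polynomial.X * Polynomial.C (q i)) := by
      simp [linePoly]
    rw [hmul, Polynomial.mul_coeff_one, hf, coeff_zero_linePoly]
    simp [MvPolynomial.pderiv_X, Pi.single_apply, apply_ite, add_mul, Finset.sum_add_distrib,
      Finset.sum_mul]
    exact Finset.sum_congr rfl fun _ _ => by ring

/-- The coefficients of the restriction of `f` to a line through `p` depend polynomially on the
direction of the line. -/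
theorem exists_eval_eq_coeff_linePoly (f : MvPolynomial (Fin (n + 1)) K) (p : Fin (n + 1) → K)
    (k : ℕ) : ∃ g : MvPolynomial (Fin (n + 1)) K,
      ∀ q, MvPolynomial.eval q g = (linePoly f p q).coeff k := by
  refine ⟨(MvPolynomial.aeval (fun i => Polynomial.C (MvPolynomial.C (p i)) +
    Polynomial.X * Polynomial.C (MvPolynomial.X i)) f : (MvPolynomial (Fin (n + 1)) K)[X]).coeff k,
    fun q => ?_⟩
  rw [← Polynomial.coeff_map]
  congr 1
  induction f using MvPolynomial.induction_on with
  | C a =>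
    simp [linePoly, Polynomial.algebraMap_eq, MvPolynomial.algebraMap_eq,
      IsScalarTower.algebraMap_apply K (MvPolynomial (Fin (n + 1)) K)
        (MvPolynomial (Fin (n + 1)) K)[X]]
  | add f g hf hg => simp_all [linePoly]
  | mul_X f i hf => simp_all [linePoly]

end LinePoly

theorem le_contactOrder {K : Type} [Field K] {n m : ℕ} (f : MvPolynomial (Fin (n + 1)) K)
    (p q : Fin (n + 1) → K) (h : ∀ k < m, (linePoly f p q).coeff k = 0) :
    (m : ℕ∞) ≤ contactOrder f p q := by
  unfold contactOrder
  split_ifs with h0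
  · exact le_top
  · rw [Nat.cast_le, Polynomial.le_rootMultiplicity_iff h0, map_zero, sub_zero,
      Polynomial.X_pow_dvd_iff]
    exact h

theorem singular_point_is_flex
    (K : Type) [Field K] [IsAlgClosed K] [CharZero K] (n d : ℕ) (hn : 1 ≤ n)
    (f : MvPolynomial (Fin (n + 1)) K) (hf : f.IsHomogeneous d) (hsf : Squarefree f)
    (p : Fin (n + 1) → K) (hp : p ≠ 0) (hpV : MvPolynomial.eval p f = 0)
    (hsing : ∀ i, MvPolynomial.eval p (MvPolynomial.pderiv i f) = 0) :
    ∃ q : Fin (n + 1) → K, q ≠ 0 ∧ (¬∃ c : K, q = c • p) ∧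
      ((n + 1 : ℕ) : ℕ∞) ≤ contactOrder f p q := by
  obtain ⟨i₀, hi₀⟩ : ∃ i, p i ≠ 0 := by
    by_contra! h
    exact hp (funext h)
  choose g hg using exists_eval_eq_coeff_linePoly f p
  obtain ⟨q, hq0, hq⟩ := exists_ne_zero_forall_eval_eq_zero (Nat.lt_succ_self n)
    (fun j : Fin n => if (j : ℕ) = 0 then MvPolynomial.X i₀ else g (j + 1)) (by
      intro j
      split_ifs with hj
      · simp
      · rw [hg, linePoly_zero_right, Polynomial.coeff_C_succ])
  have hqi : q i₀ = 0 := by simpa using hq ⟨0, hn⟩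
  refine ⟨q, hq0, ?_, le_contactOrder f p q fun k hk => ?_⟩
  · rintro ⟨c, rfl⟩
    have hc : c = 0 := by simpa [hi₀] using hqi
    exact hq0 (by simp [hc])
  · rcases k with _ | _ | k
    · rw [coeff_zero_linePoly, hpV]
    · rw [zero_add, coeff_one_linePoly]
      simp [hsing]
    · rw [← hg]
      simpa using hq ⟨k + 1, by omega⟩
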